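/- Let (ℙ^{s,η})_{(s,η)∈ℝ₊×Ω} be a path-dependent canonical class satisfying Hypothesis (H). Let M be a real F^o-adapted process, ℙ^{s,η}-integrable at each time, such that for every (s,η) ∈ ℝ₊×Ω, M is a (ℙ^{s,η},F^o)-martingale on [s,+∞). Then for every (s,η), the process t ↦ M_{t∨s} − M_s admits a ℙ^{s,η}-version M^{s,η} which is a cadlag (ℙ^{s,η},F^{s,η})-martingale vanishing on [0,s]. In particular, M_{t,u}(ω) := M_u(ω) − M_t(ω) defines a path-dependent MAF whose cadlag version under ℙ^{s,η} is M^{s,η}. -/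

import Mathlib

open MeasureTheory Filter Topology Set
open scoped NNReal ENNReal

noncomputable section

/-- A function indexed by `ℝ≥0` is *cadlag* if it is right-continuous and has
left limits at every positive time. -/
def IsCadlag {X : Type*} [TopologicalSpace X] (f : ℝ≥0 → X) : Prop :=
  (∀ t : ℝ≥0, Tendsto f (𝓝[Set.Ici t] t) (𝓝 (f t))) ∧
    ∀ t : ℝ≥0, 0 < t → ∃ l : X, Tendsto f (𝓝[Set.Iio t] t) (𝓝 l)

variable (E : Type*) [TopologicalSpace E] [MeasurableSpace E]

/-- The canonical path space `Ω = D(ℝ₊, E)` of cadlag paths with values in `E`. -/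
def PathOmega := {f : ℝ≥0 → E // IsCadlag f}

/-- The canonical σ-field `𝓕 = σ(X_r ; r ≥ 0)` on the path space. -/
instance instPathOmegaMS : MeasurableSpace (PathOmega E) :=
  ⨆ r : ℝ≥0, MeasurableSpace.comap (fun ω : PathOmega E => ω.1 r) inferInstance

/-- The initial filtration `𝓕^o_t = σ(X_r ; r ≤ t)`. -/
def Fot (t : ℝ≥0) : MeasurableSpace (PathOmega E) :=
  ⨆ r ∈ Set.Iic t, MeasurableSpace.comap (fun ω : PathOmega E => ω.1 r) inferInstance

/-- The canonical (right-continuous) filtration `𝓕_t = ⋂_{s > t} 𝓕^o_s`. -/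
def Ft (t : ℝ≥0) : MeasurableSpace (PathOmega E) :=
  ⨅ u ∈ Set.Ioi t, Fot E u

variable {E}

/-- A *path-dependent canonical class*. -/
structure IsPathCanonicalClass (P : ℝ≥0 → PathOmega E → Measure (PathOmega E)) : Prop where
  isProb : ∀ s η, IsProbabilityMeasure (P s η)
  starts : ∀ (s : ℝ≥0) (η : PathOmega E), P s η {ω | ∀ r ≤ s, ω.1 r = η.1 r} = 1
  fos_meas : ∀ (s : ℝ≥0) (F : Set (PathOmega E)), MeasurableSet F →
    Measurable[Fot E s] fun η => P s η F
  cond : ∀ (s : ℝ≥0) (η : PathOmega E) (t : ℝ≥0), s ≤ t →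
    ∀ F : Set (PathOmega E), MeasurableSet F →
      ∀ G : Set (PathOmega E), MeasurableSet[Fot E t] G →
        ∫⁻ ω in G, P t ω F ∂(P s η) = P s η (F ∩ G)

variable (E)

/-- The `ℙ`-closure of a sub-σ-field `G`: the σ-field generated by `G` and the
`ℙ`-null sets of the ambient σ-field. -/
def pClosure {Ω : Type*} {m0 : MeasurableSpace Ω} (G : MeasurableSpace Ω)
    (μ : @Measure Ω m0) : MeasurableSpace Ω :=
  G ⊔ MeasurableSpace.generateFrom {s | MeasurableSet[m0] s ∧ μ s = 0}


/-- Hypothesis (H): the conditioning property of the canonical class holds with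
respect to the canonical filtration `𝓕_t` (and not only `𝓕^o_t`). -/
def HypH (P : ℝ≥0 → PathOmega E → Measure (PathOmega E)) : Prop :=
  ∀ (s : ℝ≥0) (η : PathOmega E) (t : ℝ≥0), s ≤ t →
    ∀ F : Set (PathOmega E), MeasurableSet F →
      ∀ G : Set (PathOmega E), MeasurableSet[Ft E t] G →
        ∫⁻ ω in G, P t ω F ∂(P s η) = P s η (F ∩ G)


/-- A process `M` is a martingale on `[s, ∞)` with respect to the measure `μ`
and the filtration `𝔽`: it is integrable at each time `t ≥ s` and has the
martingale property for `s ≤ t ≤ u`, expressed through set integrals over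
`𝔽 t`-measurable events. -/
def IsMartingaleOn (μ : Measure (PathOmega E))
    (𝔽 : ℝ≥0 → MeasurableSpace (PathOmega E))
    (M : ℝ≥0 → PathOmega E → ℝ) (s : ℝ≥0) : Prop :=
  (∀ t : ℝ≥0, s ≤ t → Integrable (M t) μ) ∧
    ∀ t u : ℝ≥0, s ≤ t → t ≤ u → ∀ G : Set (PathOmega E), MeasurableSet[𝔽 t] G →
      ∫ ω in G, M u ω ∂μ = ∫ ω in G, M t ω ∂μ

/-- `UpChain x a b S k u` says that `x` upcrosses `[a, b]` at least `k` times along points of `S`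
located after `u`. -/
def UpChain {ι : Type*} [LinearOrder ι] (x : ι → ℝ) (a b : ℝ) (S : Set ι) : ℕ → ι → Prop
  | 0, _ => True
  | k + 1, u => ∃ p ∈ S, ∃ q ∈ S, u ≤ p ∧ p ≤ q ∧ x p ≤ a ∧ b ≤ x q ∧ UpChain x a b S k q

lemma UpChain.anti {ι : Type*} [LinearOrder ι] {x : ι → ℝ} {a b : ℝ} {S : Set ι} {k : ℕ} {u v : ι}
    (h : UpChain x a b S k v) (huv : u ≤ v) : UpChain x a b S k u := by
  cases k with
  | zero => trivial
  | succ k =>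
    obtain ⟨p, hp, q, hq, hup, h⟩ := h
    exact ⟨p, hp, q, hq, huv.trans hup, h⟩

lemma UpChain.upperCrossingTime_lt {Ω : Type*} {f : ℕ → Ω → ℝ} {ω : Ω} {a b : ℝ} {N k : ℕ} :
    ∀ {j i : ℕ}, UpChain (fun m => f m ω) a b (Iio N) k i → upperCrossingTime a b f N j ω ≤ i →
      upperCrossingTime a b f N j ω < N → upperCrossingTime a b f N (j + k) ω < N := by
  induction k with
  | zero => exact fun _ _ h => h
  | succ k ih =>
    rintro j i ⟨p, hp, q, hq, hip, hpq, hxp, hxq, h⟩ hji -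
    have hlow : lowerCrossingTime a b f N j ω ≤ p :=
      hittingBtwn_le_of_mem (hji.trans hip) (le_of_lt hp) hxp
    have hup : upperCrossingTime a b f N (j + 1) ω ≤ q := by
      rw [upperCrossingTime_succ_eq]
      exact hittingBtwn_le_of_mem (hlow.trans hpq) (le_of_lt hq) hxq
    rw [← Nat.add_assoc, Nat.add_right_comm]
    exact ih h hup (hup.trans_lt hq)

lemma UpChain.le_upcrossingsBefore {Ω : Type*} {f : ℕ → Ω → ℝ} {ω : Ω} {a b : ℝ} {N k : ℕ}
    (hab : a < b) (hN : 0 < N) (h : UpChain (fun m => f m ω) a b (Iio N) k 0) :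
    k ≤ upcrossingsBefore a b f N ω := by
  refine le_csSup (upperCrossingTime_lt_bddAbove hab) ?_
  have := UpChain.upperCrossingTime_lt (j := 0) h le_rfl hN
  rwa [zero_add] at this

/-- The nonnegative dyadic numbers. -/
def dyadics : Set ℝ≥0 := {x | ∃ n k : ℕ, x = k / 2 ^ n}

lemma eventually_eq_of_mem_dyadics {x : ℝ≥0} (hx : x ∈ dyadics) :
    ∀ᶠ n : ℕ in atTop, ∃ k : ℕ, x = k / 2 ^ n := by
  obtain ⟨m, k, rfl⟩ := hx
  filter_upwards [eventually_ge_atTop m] with n hn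
  obtain ⟨d, rfl⟩ := Nat.exists_eq_add_of_le hn
  refine ⟨k * 2 ^ d, ?_⟩
  push_cast
  rw [pow_add, mul_div_mul_right _ _ (by positivity)]

lemma UpChain.eventually_grid {x : ℝ≥0 → ℝ} {a b : ℝ} {T k : ℕ} :
    ∀ {u : ℝ≥0}, UpChain x a b (dyadics ∩ Iio (T : ℝ≥0)) k u →
      ∀ᶠ n : ℕ in atTop, ∀ i : ℕ, (i / 2 ^ n : ℝ≥0) ≤ u →
        UpChain (fun m : ℕ => x (m / 2 ^ n)) a b (Iio (T * 2 ^ n)) k i := by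
  induction k with
  | zero => exact fun _ => .of_forall fun _ _ _ => trivial
  | succ k ih =>
    rintro u ⟨p, hp, q, hq, hup, hpq, hxp, hxq, h⟩
    filter_upwards [ih h, eventually_eq_of_mem_dyadics hp.1, eventually_eq_of_mem_dyadics hq.1]
      with n hn ⟨p', hp'⟩ ⟨q', hq'⟩ i hi
    have hpos : (0 : ℝ≥0) < 2 ^ n := by positivity
    have hlt {d : ℕ} (hd : (d / 2 ^ n : ℝ≥0) < T) : d < T * 2 ^ n := by
      rw [div_lt_iff₀ hpos] at hd
      exact_mod_cast hd
    have hle {c d : ℕ} (hd : (c / 2 ^ n : ℝ≥0) ≤ d / 2 ^ n) : c ≤ d := by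
      rw [div_le_div_iff_of_pos_right hpos] at hd
      exact_mod_cast hd
    subst hp' hq'
    exact ⟨p', hlt hp.2, q', hlt hq.2, hle (hi.trans hup), hle hpq, hxp, hxq, hn q' le_rfl⟩

/-- Dyadic approximation from the right. -/
lemma exists_dyadic_seq_gt (t : ℝ≥0) : ∃ d : ℕ → ℝ≥0, (∀ n, d n ∈ dyadics) ∧ (∀ n, t < d n) ∧
    Tendsto d atTop (𝓝 t) := by
  refine ⟨fun n => (⌊t * 2 ^ n⌋₊ + 1 : ℕ) / 2 ^ n, fun n => ⟨n, _, rfl⟩, fun n => ?_, ?_⟩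
  · rw [lt_div_iff₀ (by positivity)]
    exact_mod_cast Nat.lt_floor_add_one (t * 2 ^ n)
  · have hlim : Tendsto (fun n : ℕ => t + (1 / 2 : ℝ≥0) ^ n) atTop (𝓝 (t + 0)) :=
      tendsto_const_nhds.add (NNReal.tendsto_pow_atTop_nhds_zero_of_lt_one (by
        rw [← NNReal.coe_lt_coe]; norm_num))
    rw [add_zero] at hlim
    refine tendsto_of_tendsto_of_tendsto_of_le_of_le tendsto_const_nhds hlim (fun n => ?_)
      fun n => ?_
    · refine ((lt_div_iff₀ (by positivity)).2 ?_).le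
      exact_mod_cast Nat.lt_floor_add_one (t * 2 ^ n)
    · change ((⌊t * 2 ^ n⌋₊ + 1 : ℕ) / 2 ^ n : ℝ≥0) ≤ t + (1 / 2 : ℝ≥0) ^ n
      rw [div_le_iff₀ (by positivity), add_mul, ← mul_pow]
      have := Nat.floor_le (zero_le (a := t * 2 ^ n))
      have h1 : (1 / 2 * 2 : ℝ≥0) = 1 := by norm_num
      push_cast
      rw [h1, one_pow]
      gcongr

instance neBot_nhdsWithin_dyadics (t : ℝ≥0) : (𝓝[dyadics ∩ Ioi t] t).NeBot := by
  obtain ⟨d, hd, htd, hlim⟩ := exists_dyadic_seq_gt t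
  have h : Tendsto d atTop (𝓝[dyadics ∩ Ioi t] t) :=
    tendsto_nhdsWithin_iff.2 ⟨hlim, .of_forall fun n => ⟨hd n, htd n⟩⟩
  exact h.neBot

/-- Boundedness and absence of infinitely many upcrossings give one-sided limits along the
dyadics. -/
lemma exists_tendsto_dyadics {x : ℝ≥0 → ℝ}
    (hb : ∀ T : ℕ, ∃ R : ℝ, ∀ d ∈ dyadics ∩ Iio (T : ℝ≥0), |x d| ≤ R)
    (hc : ∀ (T : ℕ) (a b : ℚ), a < b → ∃ k, ¬ UpChain x a b (dyadics ∩ Iio (T : ℝ≥0)) k 0)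
    (t : ℝ≥0) :
    (∃ l, Tendsto x (𝓝[dyadics ∩ Ioi t] t) (𝓝 l)) ∧
      ∃ l, Tendsto x (𝓝[dyadics ∩ Iio t] t) (𝓝 l) := by
  obtain ⟨T, hT⟩ := exists_nat_gt t
  have hTt : ∀ᶠ d in 𝓝 t, d < (T : ℝ≥0) := Iio_mem_nhds hT
  obtain ⟨R, hR⟩ := hb T
  have key {F : Filter ℝ≥0} (hF : ∀ᶠ d in F, d ∈ dyadics ∩ Iio (T : ℝ≥0))
      (hch : ∀ a b : ℝ, (∃ᶠ d in F, x d < a) → (∃ᶠ d in F, b < x d) →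
        ∀ k, UpChain x a b (dyadics ∩ Iio (T : ℝ≥0)) k 0) : ∃ l, Tendsto x F (𝓝 l) := by
    refine tendsto_of_no_upcrossings (Rat.denseRange_cast (𝕜 := ℝ)) ?_
      ⟨R, eventually_map.2 (hF.mono fun d hd => (abs_le.1 (hR d hd)).2)⟩
      ⟨-R, eventually_map.2 (hF.mono fun d hd => (abs_le.1 (hR d hd)).1)⟩
    rintro _ ⟨a, rfl⟩ _ ⟨b, rfl⟩ hab ⟨ha, hb⟩
    obtain ⟨k, hk⟩ := hc T a b (by exact_mod_cast hab)
    exact hk (hch a b ha hb k)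
  constructor
  · have hF : ∀ᶠ d in 𝓝[dyadics ∩ Ioi t] t, d ∈ dyadics ∩ Iio (T : ℝ≥0) := by
      filter_upwards [self_mem_nhdsWithin, hTt.filter_mono nhdsWithin_le_nhds] with d h1 h2
      exact ⟨h1.1, h2⟩
    refine key hF fun a b ha hb k => ?_
    have hnear {v : ℝ≥0} (hv : t < v) : ∀ᶠ d in 𝓝[dyadics ∩ Ioi t] t,
        d ∈ dyadics ∩ Iio (T : ℝ≥0) ∧ t < d ∧ d < v := by
      filter_upwards [hF, self_mem_nhdsWithin,
        nhdsWithin_le_nhds (Iio_mem_nhds hv)] with d h1 h2 h3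
      exact ⟨h1, h2.2, h3⟩
    suffices ∃ u > t, UpChain x a b (dyadics ∩ Iio (T : ℝ≥0)) k u by
      obtain ⟨u, -, hu⟩ := this
      exact hu.anti zero_le
    induction k with
    | zero => exact ⟨t + 1, lt_add_one t, trivial⟩
    | succ k ih =>
      obtain ⟨u, htu, hu⟩ := ih
      obtain ⟨q, hbq, hq, htq, hqu⟩ := (hb.and_eventually (hnear htu)).exists
      obtain ⟨p, hap, hp, htp, hpq⟩ := (ha.and_eventually (hnear htq)).exists
      exact ⟨p, htp, p, hp, q, hq, le_rfl, hpq.le, hap.le, hbq.le, hu.anti hqu.le⟩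
  · have hF : ∀ᶠ d in 𝓝[dyadics ∩ Iio t] t, d ∈ dyadics ∩ Iio (T : ℝ≥0) := by
      filter_upwards [self_mem_nhdsWithin, hTt.filter_mono nhdsWithin_le_nhds] with d h1 h2
      exact ⟨h1.1, h2⟩
    refine key hF fun a b ha hb k => ?_
    have hnear {v : ℝ≥0} (hv : v < t) : ∀ᶠ d in 𝓝[dyadics ∩ Iio t] t,
        d ∈ dyadics ∩ Iio (T : ℝ≥0) ∧ d < t ∧ v < d := by
      filter_upwards [hF, self_mem_nhdsWithin,
        nhdsWithin_le_nhds (Ioi_mem_nhds hv)] with d h1 h2 h3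
      exact ⟨h1, h2.2, h3⟩
    obtain ⟨d₀, -, hd₀⟩ := (ha.and_eventually self_mem_nhdsWithin).exists
    suffices ∀ u < t, UpChain x a b (dyadics ∩ Iio (T : ℝ≥0)) k u from
      this 0 (zero_le.trans_lt hd₀.2)
    induction k with
    | zero => exact fun _ _ => trivial
    | succ k ih =>
      intro u hu
      obtain ⟨p, hap, hp, hpt, hup⟩ := (ha.and_eventually (hnear hu)).exists
      obtain ⟨q, hbq, hq, hqt, hpq⟩ := (hb.and_eventually (hnear hpt)).exists
      exact ⟨p, hp, q, hq, hup.le, hpq.le, hap.le, hbq.le, ih q hqt⟩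

/-- If `x` has one-sided limits along the dyadics, its right limits form a cadlag function. -/
lemma isCadlag_of_tendsto_dyadics {x y : ℝ≥0 → ℝ}
    (hr : ∀ t, Tendsto x (𝓝[dyadics ∩ Ioi t] t) (𝓝 (y t)))
    (hl : ∀ t, ∃ l, Tendsto x (𝓝[dyadics ∩ Iio t] t) (𝓝 l)) : IsCadlag y := by
  have key {U : Set ℝ≥0} (hU : IsOpen U) {t : ℝ≥0} {l : ℝ}
      (h : Tendsto x (𝓝[dyadics ∩ U] t) (𝓝 l)) : Tendsto y (𝓝[U] t) (𝓝 l) := by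
    refine (closed_nhds_basis l).tendsto_right_iff.2 fun W ⟨hW, hWc⟩ => ?_
    obtain ⟨O, hO, htO, hOW⟩ := mem_nhdsWithin.1 (h hW)
    filter_upwards [self_mem_nhdsWithin, mem_nhdsWithin_of_mem_nhds (hO.mem_nhds htO)] with u huU huO
    refine hWc.mem_of_tendsto (hr u) ?_
    filter_upwards [self_mem_nhdsWithin,
      mem_nhdsWithin_of_mem_nhds ((hO.inter hU).mem_nhds ⟨huO, huU⟩)] with d hd hdO
    exact hOW ⟨hdO.1, hd.1, hdO.2⟩
  refine ⟨fun t => ?_, fun t _ => ?_⟩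
  · rw [← Ioi_insert, nhdsWithin_insert]
    exact (tendsto_pure_nhds _ _).sup (key isOpen_Ioi (hr t))
  · obtain ⟨l, h⟩ := hl t
    exact ⟨l, key isOpen_Iio h⟩

section Regularization

variable {Ω : Type*} {m0 : MeasurableSpace Ω} {μ : Measure Ω} {𝔽 : Filtration ℝ≥0 m0}
  {X : ℝ≥0 → Ω → ℝ}

/-- A filtration observed at the times of level `n` dyadics. -/
def gridFiltration (𝔽 : Filtration ℝ≥0 m0) (n : ℕ) : Filtration ℕ m0 where
  seq k := 𝔽 (k / 2 ^ n)
  mono' _ _ hij := 𝔽.mono (by gcongr)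
  le' _ := 𝔽.le _

lemma MeasureTheory.Martingale.grid (hX : Martingale X 𝔽 μ) (n : ℕ) :
    Martingale (fun k : ℕ => X (k / 2 ^ n)) (gridFiltration 𝔽 n) μ :=
  ⟨fun _ => hX.1 _, fun _ _ hij => hX.2 _ _ (by gcongr)⟩

lemma grid_last (T n : ℕ) : (((T * 2 ^ n : ℕ) : ℝ≥0) / 2 ^ n) = T := by
  push_cast
  exact mul_div_cancel_right₀ _ (by positivity)

lemma MeasureTheory.Martingale.ae_exists_not_upChain [IsFiniteMeasure μ]
    (hX : Martingale X 𝔽 μ) (T : ℕ) {a b : ℝ} (hab : a < b) :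
    ∀ᵐ ω ∂μ, ∃ k, ¬ UpChain (X · ω) a b (dyadics ∩ Iio (T : ℝ≥0)) k 0 := by
  rcases Nat.eq_zero_or_pos T with rfl | hT
  · refine .of_forall fun ω => ⟨1, ?_⟩
    rintro ⟨p, hp, -⟩
    simpa using hp.2
  let f : ℕ → ℕ → Ω → ℝ := fun n k => X (k / 2 ^ n)
  let U : ℕ → Ω → ℝ≥0∞ := fun n ω => (upcrossingsBefore a b (f n) (T * 2 ^ n) ω : ℕ)
  have hU (n : ℕ) : Measurable (U n) :=
    measurable_from_top.comp ((hX.grid n).stronglyAdapted.measurable_upcrossingsBefore hab)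
  have hbound (n : ℕ) : ∫⁻ ω, U n ω ∂μ ≤ ENNReal.ofReal ((∫ ω, (X T ω - a)⁺ ∂μ) / (b - a)) := by
    have h := (hX.grid n).submartingale.mul_integral_upcrossingsBefore_le_integral_pos_part
      a b (T * 2 ^ n)
    rw [grid_last, mul_comm, ← le_div_iff₀ (sub_pos.2 hab)] at h
    refine le_trans (le_of_eq ?_) (ENNReal.ofReal_le_ofReal h)
    rw [ofReal_integral_eq_lintegral_ofReal
      ((hX.grid n).stronglyAdapted.integrable_upcrossingsBefore hab)
      (.of_forall fun _ => Nat.cast_nonneg _)]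
    simp [U, f]
  have hfin : ∫⁻ ω, liminf (fun n => U n ω) atTop ∂μ ≠ ∞ := by
    refine ne_top_of_le_ne_top ENNReal.ofReal_ne_top ((lintegral_liminf_le hU).trans
      (liminf_le_of_frequently_le' (Frequently.of_forall hbound)))
  filter_upwards [ae_lt_top (Measurable.liminf hU) hfin] with ω hω
  by_contra! hall
  refine hω.ne (ENNReal.eq_top_of_forall_nnreal_le fun r => ?_)
  obtain ⟨k, hk⟩ := exists_nat_ge r
  refine le_liminf_of_le (by isBoundedDefault) ?_
  filter_upwards [(hall k).eventually_grid] with n hn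
  have h : k ≤ upcrossingsBefore a b (f n) (T * 2 ^ n) ω :=
    UpChain.le_upcrossingsBefore hab (by positivity) (hn 0 (by simp))
  calc (r : ℝ≥0∞) ≤ (k : ℕ) := by exact_mod_cast hk
    _ ≤ U n ω := Nat.cast_le.2 h

lemma MeasureTheory.Martingale.ae_exists_bound [IsFiniteMeasure μ]
    (hX : Martingale X 𝔽 μ) (T : ℕ) :
    ∀ᵐ ω ∂μ, ∃ R : ℝ, ∀ d ∈ dyadics ∩ Iio (T : ℝ≥0), |X d ω| ≤ R := by
  have hsub (n : ℕ) : Submartingale (fun (k : ℕ) ω => |X (k / 2 ^ n) ω|) (gridFiltration 𝔽 n) μ :=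
    (hX.grid n).submartingale.sup (hX.grid n).neg.submartingale
  let A (R n : ℕ) : Set Ω := {ω | ∃ k ≤ T * 2 ^ n, (R : ℝ) ≤ |X (k / 2 ^ n) ω|}
  have hA (R n : ℕ) : R * μ (A R n) ≤ ENNReal.ofReal (∫ ω, |X T ω| ∂μ) := by
    have h := maximal_ineq (hsub n) (fun _ _ => abs_nonneg _) (ε := R) (T * 2 ^ n)
    simp only [grid_last] at h
    have hAeq : A R n = {ω | ((R : ℝ≥0) : ℝ) ≤ (Finset.range (T * 2 ^ n + 1)).sup'
        Finset.nonempty_range_add_one fun k => |X (k / 2 ^ n) ω|} := by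
      ext ω
      simp [A, Finset.le_sup'_iff]
    rw [← hAeq] at h
    refine le_trans ?_ (h.trans (ENNReal.ofReal_le_ofReal ?_))
    · simp
    · exact setIntegral_le_integral (hX.integrable _).abs (.of_forall fun _ => abs_nonneg _)
  let B (R : ℕ) : Set Ω := ⋃ m, ⋂ n ≥ m, A R n
  have hB (R : ℕ) : R * μ (B R) ≤ ENNReal.ofReal (∫ ω, |X T ω| ∂μ) := by
    have hmono : Monotone fun m => ⋂ n ≥ m, A R n := fun i j hij =>
      biInter_mono (fun n (hn : j ≤ n) => hij.trans hn) fun _ _ => le_rfl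
    rw [hmono.measure_iUnion, ENNReal.mul_iSup]
    refine iSup_le fun m => le_trans ?_ (hA R m)
    gcongr
    exact biInter_subset_of_mem (mem_Ici.2 le_rfl)
  have hnull : μ (⋂ R, B R) = 0 := by
    by_contra hne
    obtain ⟨R, hR⟩ := ENNReal.exists_nat_mul_gt hne
      (ENNReal.ofReal_ne_top (r := ∫ ω, |X T ω| ∂μ))
    refine (hR.trans_le ?_).not_ge (hB R)
    gcongr
    exact iInter_subset _ _
  filter_upwards [measure_eq_zero_iff_ae_notMem.1 hnull] with ω hω
  simp only [mem_iInter, not_forall] at hω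
  obtain ⟨R, hR⟩ := hω
  refine ⟨R, fun d hd => ?_⟩
  by_contra! hlt
  obtain ⟨m, hm⟩ := eventually_atTop.1 (eventually_eq_of_mem_dyadics hd.1)
  refine hR (mem_iUnion.2 ⟨m, mem_iInter₂.2 fun n hn => ?_⟩)
  obtain ⟨k, rfl⟩ := hm n hn
  refine ⟨k, ?_, hlt.le⟩
  have := hd.2
  rw [mem_Iio, div_lt_iff₀ (by positivity)] at this
  exact_mod_cast this.le

/-- Right limits along sequences of a martingale for a right-continuous filtration recover the
martingale. -/
lemma MeasureTheory.Martingale.ae_eq_of_tendsto [IsFiniteMeasure μ] [𝔽.IsRightContinuous]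
    (hX : Martingale X 𝔽 μ) {t : ℝ≥0} {d : ℕ → ℝ≥0} (htd : ∀ n, t < d n)
    (hdt : Tendsto d atTop (𝓝 t)) {Y : Ω → ℝ}
    (hY : ∀ᵐ ω ∂μ, Tendsto (fun n => X (d n) ω) atTop (𝓝 (Y ω))) : Y =ᵐ[μ] X t := by
  let Z : Ω → ℝ := fun ω => limsup (fun n => X (d n) ω) atTop
  have hZY : Y =ᵐ[μ] Z := by
    filter_upwards [hY] with ω hω using hω.limsup_eq.symm
  have hZmeas : Measurable[𝔽 t] Z := by
    intro s hs
    refine Filtration.IsRightContinuous.measurableSet ?_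
    rw [Filtration.rightCont_eq]
    simp only [MeasurableSpace.measurableSet_iInf]
    intro u hu
    obtain ⟨m, hm⟩ := eventually_atTop.1 (hdt.eventually (Iio_mem_nhds hu))
    have hZ : Z = fun ω => limsup (fun n => X (d (n + m)) ω) atTop := by
      funext ω
      exact (limsup_nat_add (fun n => X (d n) ω) m).symm
    rw [hZ]
    refine Measurable.limsup (fun n => ?_) hs
    exact ((hX.1 _).mono (𝔽.mono (le_of_lt (hm (n + m) (Nat.le_add_left _ _))))).measurable
  have hlim : ∀ᵐ ω ∂μ, Tendsto (fun n => X (d n) ω) atTop (𝓝 (Z ω)) := by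
    filter_upwards [hY, hZY] with ω h1 h2 using h2 ▸ h1
  obtain ⟨u, hu⟩ := hdt.bddAbove_range
  have hcond (n : ℕ) : μ[X u | 𝔽 (d n)] =ᵐ[μ] X (d n) := hX.2 _ _ (hu (mem_range_self n))
  have hui : UniformIntegrable (fun n => X (d n)) 1 μ :=
    ((hX.integrable u).uniformIntegrable_condExp fun n => 𝔽.le (d n)).ae_eq hcond
  have hsm (n : ℕ) : AEStronglyMeasurable (X (d n)) μ := (hX.integrable _).1
  have hZint : MemLp Z 1 μ := hui.memLp_of_ae_tendsto hlim
  have hL1 := tendsto_Lp_finite_of_tendsto_ae le_rfl ENNReal.one_ne_top hsm hZint hui.unifIntegrable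
    hlim
  have hZi : Integrable Z μ := memLp_one_iff_integrable.1 hZint
  refine hZY.trans (ae_eq_of_forall_setIntegral_eq_of_sigmaFinite' (𝔽.le t)
    (fun _ _ _ => hZi.integrableOn) (fun _ _ _ => (hX.integrable t).integrableOn)
    (fun s hs _ => ?_) hZmeas.stronglyMeasurable.aestronglyMeasurable (hX.1 t).aestronglyMeasurable)
  refine tendsto_nhds_unique (tendsto_setIntegral_of_L1' Z hZi.1
    (.of_forall fun n => hX.integrable _) hL1 s) ?_
  simp only [← hX.setIntegral_eq (htd _).le hs]
  exact tendsto_const_nhds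

/-- A martingale with respect to a right-continuous filtration has a cadlag modification. -/
theorem MeasureTheory.Martingale.exists_cadlag_modification [IsFiniteMeasure μ]
    [𝔽.IsRightContinuous] (hX : Martingale X 𝔽 μ) :
    ∃ Y : ℝ≥0 → Ω → ℝ, (∀ ω, IsCadlag fun t => Y t ω) ∧ (∀ t, Measurable (Y t)) ∧
      ∀ t, Y t =ᵐ[μ] X t := by
  have hmeas (t : ℝ≥0) : Measurable (X t) := ((hX.1 t).mono (𝔽.le t)).measurable
  have hgood : ∀ᵐ ω ∂μ, ∀ t, (∃ l, Tendsto (X · ω) (𝓝[dyadics ∩ Ioi t] t) (𝓝 l)) ∧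
      ∃ l, Tendsto (X · ω) (𝓝[dyadics ∩ Iio t] t) (𝓝 l) := by
    have hchain : ∀ᵐ ω ∂μ, ∀ (T : ℕ) (a b : ℚ), a < b →
        ∃ k, ¬ UpChain (X · ω) a b (dyadics ∩ Iio (T : ℝ≥0)) k 0 := by
      simp only [ae_all_iff]
      exact fun T a b hab => hX.ae_exists_not_upChain T (by exact_mod_cast hab)
    filter_upwards [hchain, ae_all_iff.2 hX.ae_exists_bound] with ω h1 h2
    exact exists_tendsto_dyadics h2 h1
  obtain ⟨N, hN_sub, hN, hNnull⟩ := exists_measurable_superset_of_null (ae_iff.1 hgood)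
  have hN_ae : ∀ᵐ ω ∂μ, ω ∉ N := measure_eq_zero_iff_ae_notMem.1 hNnull
  have hlim (ω : Ω) (t : ℝ≥0) :
      (∃ l, Tendsto (fun d => Nᶜ.indicator (X d) ω) (𝓝[dyadics ∩ Ioi t] t) (𝓝 l)) ∧
        ∃ l, Tendsto (fun d => Nᶜ.indicator (X d) ω) (𝓝[dyadics ∩ Iio t] t) (𝓝 l) := by
    by_cases hω : ω ∈ N
    · simp only [indicator_of_notMem (show ω ∉ Nᶜ from fun h => h hω)]
      exact ⟨⟨0, tendsto_const_nhds⟩, ⟨0, tendsto_const_nhds⟩⟩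
    · simp only [indicator_of_mem (show ω ∈ Nᶜ from hω)]
      exact not_not.1 (fun h => hω (hN_sub h)) t
  choose y hy using fun ω t => (hlim ω t).1
  refine ⟨fun t ω => y ω t, fun ω => isCadlag_of_tendsto_dyadics (hy ω) fun t => (hlim ω t).2,
    fun t => ?_, fun t => ?_⟩
  all_goals
    obtain ⟨d, hd, htd, hdt⟩ := exists_dyadic_seq_gt t
    have hseq : Tendsto d atTop (𝓝[dyadics ∩ Ioi t] t) :=
      tendsto_nhdsWithin_iff.2 ⟨hdt, .of_forall fun n => ⟨hd n, htd n⟩⟩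
  · exact measurable_of_tendsto_metrizable (fun n => (hmeas (d n)).indicator hN.compl)
      (tendsto_pi_nhds.2 fun ω => (hy ω t).comp hseq)
  · refine hX.ae_eq_of_tendsto htd hdt ?_
    filter_upwards [hN_ae] with ω hω
    have := (hy ω t).comp hseq
    simp only [Function.comp_def, indicator_of_mem (show ω ∈ Nᶜ from hω)] at this
    exact this

end Regularization
section CanonicalClass

variable {E}

lemma measurable_eval (r : ℝ≥0) : Measurable fun ω : PathOmega E => ω.1 r :=
  Measurable.of_comap_le (le_iSup (fun r : ℝ≥0 =>
    MeasurableSpace.comap (fun ω : PathOmega E => ω.1 r) inferInstance) r)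

lemma Fot_mono : Monotone (Fot E) := fun _ _ h =>
  biSup_mono fun _ hr => le_trans hr h

lemma Fot_le (t : ℝ≥0) : Fot E t ≤ instPathOmegaMS E :=
  iSup₂_le fun r _ => (measurable_eval r).comap_le

lemma Fot_le_Ft (t : ℝ≥0) : Fot E t ≤ Ft E t :=
  le_iInf₂ fun _ hu => Fot_mono (le_of_lt hu)

lemma Ft_le_Fot {t u : ℝ≥0} (h : t < u) : Ft E t ≤ Fot E u := iInf₂_le u h

lemma Ft_mono : Monotone (Ft E) := fun _ _ h =>
  biInf_mono fun _ hu => lt_of_le_of_lt h hu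

lemma Ft_le (t : ℝ≥0) : Ft E t ≤ instPathOmegaMS E :=
  (Ft_le_Fot (lt_add_one t)).trans (Fot_le _)

/-- Sets of `Fot E t` do not separate paths which agree up to time `t`. -/
lemma mem_iff_of_measurableSet_Fot {t : ℝ≥0} {G : Set (PathOmega E)}
    (hG : MeasurableSet[Fot E t] G) {ω η : PathOmega E} (h : ∀ r ≤ t, ω.1 r = η.1 r) :
    ω ∈ G ↔ η ∈ G := by
  have hle : Fot E t ≤ MeasurableSpace.comap
      (fun (ω : PathOmega E) (r : Iic t) => ω.1 r) MeasurableSpace.pi :=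
    iSup₂_le fun r hr => by
      have : Measurable fun f : Iic t → E => f ⟨r, hr⟩ := measurable_pi_apply _
      rw [← measurable_iff_comap_le]
      exact this.comp (comap_measurable _)
  obtain ⟨s, -, rfl⟩ := hle _ hG
  have : (fun r : Iic t => ω.1 r) = fun r : Iic t => η.1 r := funext fun r => h r r.2
  simp [this]

variable {P : ℝ≥0 → PathOmega E → Measure (PathOmega E)}

/-- Under `P t η`, a `Fot E t`-measurable function is a.s. equal to its value at `η`. -/
lemma IsPathCanonicalClass.ae_eq_const (hP : IsPathCanonicalClass P) {t : ℝ≥0}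
    {f : PathOmega E → ℝ} (hf : Measurable[Fot E t] f) (η : PathOmega E) :
    ∀ᵐ ω ∂(P t η), f ω = f η := by
  have := hP.isProb t η
  have hmeas : MeasurableSet[Fot E t] {ω | f ω = f η} := hf (measurableSet_singleton (f η))
  refine (mem_ae_iff_prob_eq_one (Fot_le t _ hmeas)).2 ?_
  refine le_antisymm prob_le_one ?_
  rw [← hP.starts t η]
  exact measure_mono fun ω hω => (mem_iff_of_measurableSet_Fot hmeas hω).2 rfl

/-- The kernel `ω ↦ P t ω` of a canonical class. -/
def IsPathCanonicalClass.kernel (hP : IsPathCanonicalClass P) (t : ℝ≥0) :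
    ProbabilityTheory.Kernel (PathOmega E) (PathOmega E) where
  toFun := P t
  measurable' := Measure.measurable_of_measurable_coe _ fun F hF =>
    (hP.fos_meas t F hF).mono (Fot_le t) le_rfl

/-- Under Hypothesis (H), martingales for `Fot` under every `P s η` are martingales for `Ft`. -/
lemma IsMartingaleOn.of_hypH (hP : IsPathCanonicalClass P) (hH : HypH E P)
    {M : ℝ≥0 → PathOmega E → ℝ} (hAdapted : ∀ t : ℝ≥0, Measurable[Fot E t] (M t))
    (hMart : ∀ (s : ℝ≥0) (η : PathOmega E), IsMartingaleOn E (P s η) (Fot E) M s)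
    (s : ℝ≥0) (η : PathOmega E) : IsMartingaleOn E (P s η) (Ft E) M s := by
  refine ⟨(hMart s η).1, fun t u hst htu G hG => ?_⟩
  have hprob := hP.isProb
  have hbind : ((P s η).restrict G).bind (hP.kernel t) = (P s η).restrict G := by
    ext F hF
    rw [Measure.bind_apply hF (hP.kernel t).aemeasurable, Measure.restrict_apply hF]
    exact hH s η t hst F hF G hG
  have hint : Integrable (M u) (((P s η).restrict G).bind (hP.kernel t)) := by
    rw [hbind]
    exact ((hMart s η).1 u (hst.trans htu)).integrableOn
  conv_lhs => rw [← hbind]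
  rw [Measure.comp_eq_comp_const_apply] at hint ⊢
  rw [ProbabilityTheory.Kernel.integral_comp hint, ProbabilityTheory.Kernel.const_apply]
  refine integral_congr_ae (.of_forall fun ω => ?_)
  calc ∫ ω', M u ω' ∂(P t ω) = ∫ ω', M t ω' ∂(P t ω) := by
        simpa using (hMart t ω).2 t u le_rfl htu univ MeasurableSet.univ
    _ = ∫ _, M t ω ∂(P t ω) := integral_congr_ae (hP.ae_eq_const (hAdapted t) ω)
    _ = M t ω := by simp

end CanonicalClass

section PClosure

variable {Ω : Type*} {G m0 : MeasurableSpace Ω} {μ : Measure Ω}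

lemma exists_measurableSet_of_pClosure {s : Set Ω}
    (hs : MeasurableSet[pClosure G μ] s) : ∃ t, MeasurableSet[G] t ∧ s =ᵐ[μ] t := by
  have hle : pClosure G μ ≤ @eventuallyMeasurableSpace Ω G (ae μ) _ := by
    refine sup_le (fun s hs => ⟨s, hs, .rfl⟩) (MeasurableSpace.generateFrom_le fun s hs => ?_)
    exact ⟨∅, @MeasurableSet.empty _ G, ae_eq_empty.2 hs.2⟩
  exact hle _ hs

lemma measurable_pClosure_of_ae_eq (hG : G ≤ m0) {f g : Ω → ℝ} (hf : Measurable f)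
    (hg : Measurable[G] g) (hfg : f =ᵐ[μ] g) : Measurable[pClosure G μ] f := by
  intro s hs
  have hnull {t : Set Ω} (ht : MeasurableSet t) (h0 : μ t = 0) : MeasurableSet[pClosure G μ] t :=
    (le_sup_right : MeasurableSpace.generateFrom _ ≤ pClosure G μ) _
      (MeasurableSpace.measurableSet_generateFrom ⟨ht, h0⟩)
  have hgs : MeasurableSet[pClosure G μ] (g ⁻¹' s) := 
    (le_sup_left : G ≤ pClosure G μ) _ (hg hs)
  have hfs : MeasurableSet (f ⁻¹' s) := hf hs
  have hgs' : MeasurableSet (g ⁻¹' s) := hG _ (hg hs)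
  have hae : f ⁻¹' s =ᵐ[μ] g ⁻¹' s := hfg.preimage s
  obtain ⟨h1, h2⟩ := ae_eq_set.1 hae
  have heq : f ⁻¹' s = (g ⁻¹' s \ (g ⁻¹' s \ f ⁻¹' s)) ∪ (f ⁻¹' s \ g ⁻¹' s) := by
    ext ω; simp; tauto
  rw [heq]
  exact (hgs.diff (hnull (hgs'.diff hfs) h2)).union (hnull (hfs.diff hgs') h1)

end PClosure

lemma IsCadlag.stopped_increment {f : ℝ≥0 → ℝ} (hf : IsCadlag f) (s : ℝ≥0) :
    IsCadlag fun t => f (max t s) - f s := by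
  have hmax (t : ℝ≥0) : Tendsto (fun t : ℝ≥0 => max t s) (𝓝 t) (𝓝 (max t s)) :=
    (continuous_id.max continuous_const).tendsto t
  refine ⟨fun t => ?_, fun t ht => ?_⟩
  · refine ((hf.1 (max t s)).comp (tendsto_nhdsWithin_iff.2
      ⟨(hmax t).mono_left nhdsWithin_le_nhds, ?_⟩)).sub_const _
    filter_upwards [self_mem_nhdsWithin] with u hu using max_le_max_right s hu
  · rcases le_or_gt t s with hts | hst
    · refine ⟨0, tendsto_const_nhds.congr' ?_⟩
      filter_upwards [self_mem_nhdsWithin] with u hu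
      rw [max_eq_right ((le_of_lt hu).trans hts), sub_self]
    · obtain ⟨l, hl⟩ := hf.2 t ht
      refine ⟨l - f s, (hl.congr' ?_).sub_const _⟩
      filter_upwards [mem_nhdsWithin_of_mem_nhds (Ioi_mem_nhds hst)] with u hu
      rw [max_eq_left (le_of_lt hu)]

/-- Lemma 3.3: let `M` be an `𝓕^o`-adapted process which is,
under every `ℙ^{s,η}`, a `(ℙ^{s,η}, 𝓕^o)`-martingale on `[s, ∞)`.  Then for every
`(s,η)`, the process `M_{·∨s} − M_s` admits a `ℙ^{s,η}`-version `M^{s,η}` which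
is a cadlag `(ℙ^{s,η}, 𝓕^{s,η})`-martingale vanishing on `[0,s]`; in particular
`M_{t,u} := M_u − M_t` defines a path-dependent MAF whose cadlag version under
`ℙ^{s,η}` is `M^{s,η}`. -/
theorem exists_cadlag_martingale_version [PolishSpace E] [BorelSpace E]
    (P : ℝ≥0 → PathOmega E → Measure (PathOmega E))
    (hP : IsPathCanonicalClass P) (hH : HypH E P)
    (M : ℝ≥0 → PathOmega E → ℝ)
    (hAdapted : ∀ t : ℝ≥0, Measurable[Fot E t] (M t))
    (hInt : ∀ (s : ℝ≥0) (η : PathOmega E) (t : ℝ≥0), Integrable (M t) (P s η))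
    (hMart : ∀ (s : ℝ≥0) (η : PathOmega E), IsMartingaleOn E (P s η) (Fot E) M s) :
    ∀ (s : ℝ≥0) (η : PathOmega E), ∃ Ms : ℝ≥0 → PathOmega E → ℝ,
      (∀ ω, IsCadlag fun t => Ms t ω) ∧
      (∀ (t : ℝ≥0) (ω), t ≤ s → Ms t ω = 0) ∧
      (∀ t : ℝ≥0, Measurable[pClosure (Ft E t) (P s η)] (Ms t)) ∧
      IsMartingaleOn E (P s η) (fun t => pClosure (Ft E t) (P s η)) Ms 0 ∧
      (∀ t : ℝ≥0, ∀ᵐ ω ∂(P s η), Ms t ω = M (max t s) ω - M s ω) ∧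
      (∀ t u : ℝ≥0, s ≤ t → t ≤ u →
        ∀ᵐ ω ∂(P s η), M u ω - M t ω = Ms u ω - Ms t ω) := by
  intro s η
  have hprob := hP.isProb s η
  have hM := IsMartingaleOn.of_hypH hP hH hAdapted hMart s η
  let 𝔽 : Filtration ℝ≥0 (instPathOmegaMS E) :=
    { seq := fun t => Fot E (max t s)
      mono' := fun _ _ h => Fot_mono (max_le_max_right s h)
      le' := fun _ => Fot_le _ }
  have h𝔽 (t : ℝ≥0) : 𝔽.rightCont t ≤ Ft E (max t s) := by
    rw [Filtration.rightCont_eq]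
    refine le_iInf₂ fun u hu => iInf₂_le_of_le u ((le_max_left _ _).trans_lt hu) ?_
    exact Fot_mono (max_le le_rfl ((le_max_right t s).trans (le_of_lt hu)))
  have hX : Martingale (fun t => M (max t s)) 𝔽.rightCont (P s η) := by
    have hsm : StronglyAdapted 𝔽.rightCont fun t => M (max t s) := fun t =>
      ((hAdapted (max t s)).mono (𝔽.le_rightCont t) le_rfl).stronglyMeasurable
    refine ⟨hsm, fun t u htu => ?_⟩
    refine (ae_eq_condExp_of_forall_setIntegral_eq (𝔽.rightCont.le t) (hInt s η _)
      (fun _ _ _ => (hInt s η _).integrableOn) (fun G hG _ => ?_)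
      (hsm t).aestronglyMeasurable).symm
    exact (hM.2 _ _ (le_max_right t s) (max_le_max_right s htu) G (h𝔽 t _ hG)).symm
  obtain ⟨Y, hYc, hYm, hYX⟩ := hX.exists_cadlag_modification
  let Ms : ℝ≥0 → PathOmega E → ℝ := fun t ω => Y (max t s) ω - Y s ω
  have hMs (t : ℝ≥0) : ∀ᵐ ω ∂(P s η), Ms t ω = M (max t s) ω - M s ω := by
    filter_upwards [hYX (max t s), hYX s] with ω h1 h2
    simp only [Ms, h1, h2, max_self, max_assoc]
  have hMs_zero (t : ℝ≥0) (ω : PathOmega E) (hts : t ≤ s) : Ms t ω = 0 := by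
    simp only [Ms, max_eq_right hts, sub_self]
  refine ⟨Ms, fun ω => (hYc ω).stopped_increment s, hMs_zero, fun t => ?_, ⟨fun t _ => ?_,
    fun t u _ htu G hG => ?_⟩, hMs, fun t u hst htu => ?_⟩
  · rcases le_total t s with hts | hst
    · rw [show Ms t = fun _ => 0 from funext fun ω => hMs_zero t ω hts]
      exact @measurable_const _ _ _ (pClosure (Ft E t) (P s η)) _
    · refine measurable_pClosure_of_ae_eq (Ft_le t) ((hYm _).sub (hYm s)) ?_ (hMs t)
      rw [max_eq_left hst]
      exact ((hAdapted t).mono (Fot_le_Ft t) le_rfl).sub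
        ((hAdapted s).mono ((Fot_mono hst).trans (Fot_le_Ft t)) le_rfl)
  · exact ((hInt s η _).sub (hInt s η s)).congr (.symm (hMs t))
  · obtain ⟨G', hG', hGG'⟩ := exists_measurableSet_of_pClosure hG
    have hval (v : ℝ≥0) : ∫ ω in G, Ms v ω ∂(P s η) =
        ∫ ω in G', M (max v s) ω ∂(P s η) - ∫ ω in G', M s ω ∂(P s η) := by
      rw [setIntegral_congr_set hGG', ← integral_sub (hInt s η _).integrableOn
        (hInt s η s).integrableOn]
      exact integral_congr_ae (ae_restrict_of_ae (hMs v))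
    rw [hval, hval, hM.2 _ _ (le_max_right t s) (max_le_max_right s htu) G'
      (Ft_mono (le_max_left t s) _ hG')]
  · filter_upwards [hMs t, hMs u] with ω h1 h2
    rw [h1, h2, max_eq_left hst, max_eq_left (hst.trans htu)]
    ring
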